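/- arXiv:2402.05601 — 2 statements merged into one kernel-verified Lean document; each statement's English description precedes it below -/
import Mathlib

section
/- Let K ⊂ ℝ² be a closed axis-parallel rectangle, let a, b ∈ ∂K with a ≠ b, let ξ > 0, and let S be the generalized segment from a to b in K with parameter ξ. Then for every closed connected subset S̃ ⊆ S one has ℋ¹(S̃) ≤ (1+ξ)·diam(S̃), where ℋ¹ is one-dimensional Hausdorff measure and diam is the Euclidean diameter. -/
open MeasureTheory Set Filter Topology
open scoped ENNReal NNReal

noncomputable section

/-- The plane `ℝ²` with its Euclidean structure. -/
abbrev E2 := EuclideanSpace ℝ (Fin 2)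

/-- The apex point `M` of a generalized segment between `a` and `b` with parameter `ξ`,
displaced from the midpoint of `a` and `b` by `ξ·|a-b|/2` in the inward direction `dir`. -/
def genApex (a b : E2) (ξ : ℝ) (dir : E2) : E2 :=
  midpoint ℝ a b + ((ξ * dist a b) / 2) • dir

/-- Both points lie on a common side of the axis-parallel rectangle
`[x₁,x₂] × [y₁,y₂]`. -/
def OnSameSide (x1 x2 y1 y2 : ℝ) (a b : E2) : Prop :=
  (a 0 = x1 ∧ b 0 = x1) ∨ (a 0 = x2 ∧ b 0 = x2) ∨
  (a 1 = y1 ∧ b 1 = y1) ∨ (a 1 = y2 ∧ b 1 = y2)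

/-- `S` is the generalized segment from `a` to `b` with parameter `ξ` in the rectangle
`[x₁,x₂] × [y₁,y₂]`: the straight segment if `a`, `b` are not on a common side, and
otherwise the union of the two segments joining `a` and `b` to the apex `M` lying inside
the rectangle over the midpoint of `a b` at distance `ξ|a-b|/2` from the common side. -/
def IsGenSeg (x1 x2 y1 y2 : ℝ) (a b : E2) (ξ : ℝ) (S : Set E2) : Prop :=
  (¬ OnSameSide x1 x2 y1 y2 a b ∧ S = segment ℝ a b) ∨
  (a 0 = x1 ∧ b 0 = x1 ∧
    S = segment ℝ a (genApex a b ξ (EuclideanSpace.single 0 1)) ∪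
        segment ℝ (genApex a b ξ (EuclideanSpace.single 0 1)) b) ∨
  (a 0 = x2 ∧ b 0 = x2 ∧
    S = segment ℝ a (genApex a b ξ (EuclideanSpace.single 0 (-1))) ∪
        segment ℝ (genApex a b ξ (EuclideanSpace.single 0 (-1))) b) ∨
  (a 1 = y1 ∧ b 1 = y1 ∧
    S = segment ℝ a (genApex a b ξ (EuclideanSpace.single 1 1)) ∪
        segment ℝ (genApex a b ξ (EuclideanSpace.single 1 1)) b) ∨
  (a 1 = y2 ∧ b 1 = y2 ∧
    S = segment ℝ a (genApex a b ξ (EuclideanSpace.single 1 (-1))) ∪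
        segment ℝ (genApex a b ξ (EuclideanSpace.single 1 (-1))) b)

lemma genSeg_aux (L : ℝ) (hL : 0 ≤ L) (f : E2 → ℝ) (hf : LipschitzWith 1 f) (T : Set E2)
    (hb : Bornology.IsBounded T) (h : ∀ x ∈ T, ∀ y ∈ T, dist x y ≤ L * |f x - f y|) :
    μH[1] T ≤ ENNReal.ofReal (L * Metric.diam T) := by
  classical
  set g : ℝ → E2 := Function.invFunOn f T with hg
  have hinj : InjOn f T := by
    intro x hx y hy hxy
    have := h x hx y hy
    rw [hxy, sub_self, abs_zero, mul_zero] at this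
    exact dist_le_zero.1 this
  have hgl : ∀ x ∈ T, g (f x) = x := fun x hx => hinj.leftInvOn_invFunOn hx
  have hT : g '' (f '' T) = T := by
    rw [image_image]
    ext z
    constructor
    · rintro ⟨x, hx, rfl⟩
      simpa [hgl x hx] using hx
    · intro hz
      exact ⟨z, hz, hgl z hz⟩
  have hlip : LipschitzOnWith (Real.toNNReal L) g (f '' T) := by
    apply LipschitzOnWith.of_dist_le_mul
    rintro _ ⟨x, hx, rfl⟩ _ ⟨y, hy, rfl⟩
    rw [hgl x hx, hgl y hy, Real.dist_eq, Real.coe_toNNReal _ hL]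
    exact h x hx y hy
  have h1 := hlip.hausdorffMeasure_image_le (d := 1) zero_le_one
  rw [hT, ENNReal.rpow_one, hausdorffMeasure_real] at h1
  have h2 : volume (f '' T) ≤ ENNReal.ofReal (Metric.diam T) := by
    refine (Real.volume_le_diam _).trans ((hf.ediam_image_le T).trans ?_)
    rw [Metric.diam, ENNReal.ofReal_toReal hb.ediam_ne_top]
    simp
  rw [ENNReal.ofReal_mul hL]
  exact h1.trans (mul_le_mul_right h2 _)

lemma genSeg_coord_lip (j : Fin 2) : LipschitzWith 1 (fun z : E2 => z j) := by
  apply LipschitzWith.of_dist_le_mul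
  intro x y
  simpa [dist_eq_norm] using PiLp.norm_apply_le (x - y) j

lemma genSeg_dist_le (i j : Fin 2) (hij : i ≠ j) (x y : E2) :
    dist x y ≤ |x i - y i| + |x j - y j| := by
  have key : dist x y ≤ |x 0 - y 0| + |x 1 - y 1| := by
    rw [EuclideanSpace.dist_eq, Fin.sum_univ_two, Real.dist_eq, Real.dist_eq]
    apply Real.sqrt_le_iff.2
    refine ⟨by positivity, ?_⟩
    nlinarith [abs_nonneg (x 0 - y 0), abs_nonneg (x 1 - y 1),
      mul_nonneg (abs_nonneg (x 0 - y 0)) (abs_nonneg (x 1 - y 1))]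
  fin_cases i <;> fin_cases j <;> simp_all [add_comm]

lemma genSeg_bent (i j : Fin 2) (hij : i ≠ j) (a b : E2) (hi : a i = b i) (ξ s : ℝ) (hξ : 0 < ξ)
    (hs : |s| = 1) (T : Set E2)
    (hT : T ⊆ segment ℝ a (genApex a b ξ (EuclideanSpace.single i s)) ∪
        segment ℝ (genApex a b ξ (EuclideanSpace.single i s)) b) :
    μH[1] T ≤ ENNReal.ofReal ((1 + ξ) * Metric.diam T) := by
  have hd : dist a b = |a j - b j| := by
    apply le_antisymm
    · simpa [hi] using genSeg_dist_le i j hij a b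
    · simpa [Real.dist_eq] using (genSeg_coord_lip j).dist_le_mul a b
  set M := genApex a b ξ (EuclideanSpace.single i s) with hM
  have hMi : M i = a i + s * ξ * (|a j - b j| / 2) := by
    simp [hM, genApex, midpoint_eq_smul_add, hd, ← hi]
    ring
  have hMj : M j = (a j + b j) / 2 := by
    simp [hM, genApex, midpoint_eq_smul_add, hij.symm]
    ring
  have hchar : ∀ z ∈ T, z i = a i + s * ξ * (|a j - b j| / 2 - |z j - (a j + b j) / 2|) := by
    intro z hz
    rcases hT hz with h | h
    · obtain ⟨p, q, hp, hq, hpq, rfl⟩ := h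
      have e : (p • a + q • M) j - (a j + b j) / 2 = p * ((a j - b j) / 2) := by
        simp [hMj]
        obtain rfl : q = 1 - p := by linarith
        ring
      rw [e, abs_mul, abs_of_nonneg hp, abs_div, abs_two]
      simp [hMi]
      obtain rfl : q = 1 - p := by linarith
      ring
    · obtain ⟨q, p, hq, hp, hpq, rfl⟩ := h
      have e : (q • M + p • b) j - (a j + b j) / 2 = p * (-((a j - b j) / 2)) := by
        simp [hMj]
        obtain rfl : q = 1 - p := by linarith
        ring
      rw [e, abs_mul, abs_of_nonneg hp, abs_neg, abs_div, abs_two]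
      simp [hMi, ← hi]
      obtain rfl : q = 1 - p := by linarith
      ring
  refine genSeg_aux (1 + ξ) (by linarith) (fun z => z j) (genSeg_coord_lip j) T ?_ ?_
  · have hc : ∀ x y : E2, Bornology.IsBounded (segment ℝ x y) := fun x y => by
      rw [← convexHull_pair, isBounded_convexHull]
      exact (Set.toFinite _).isBounded
    exact ((hc _ _).union (hc _ _)).subset hT
  · intro x hx y hy
    refine (genSeg_dist_le i j hij x y).trans ?_
    have e : x i - y i = s * ξ * (|y j - (a j + b j) / 2| - |x j - (a j + b j) / 2|) := by
      rw [hchar x hx, hchar y hy]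
      ring
    have e2 : |x i - y i| ≤ ξ * |x j - y j| := by
      rw [e, abs_mul, abs_mul, hs, one_mul, abs_of_pos hξ]
      apply mul_le_mul_of_nonneg_left _ hξ.le
      refine (abs_abs_sub_abs_le_abs_sub _ _).trans ?_
      rw [abs_sub_comm (x j)]
      apply le_of_eq
      congr 1
      ring
    linarith

lemma genSeg_straight (a b : E2) (ξ : ℝ) (hξ : 0 < ξ) (T : Set E2) (hT : T ⊆ segment ℝ a b) :
    μH[1] T ≤ ENNReal.ofReal ((1 + ξ) * Metric.diam T) := by
  refine genSeg_aux (1 + ξ) (by linarith) (fun z => dist z a) (LipschitzWith.dist_left a) T ?_ ?_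
  · refine Bornology.IsBounded.subset ?_ hT
    rw [← convexHull_pair, isBounded_convexHull]
    exact (Set.toFinite _).isBounded
  · intro x hx y hy
    have hx' := hT hx
    have hy' := hT hy
    rw [segment_eq_image_lineMap] at hx' hy'
    obtain ⟨p, hp, rfl⟩ := hx'
    obtain ⟨q, hq, rfl⟩ := hy'
    have : dist (AffineMap.lineMap a b p) (AffineMap.lineMap a b q) =
        |dist (AffineMap.lineMap a b p) a - dist (AffineMap.lineMap a b q) a| := by
      rw [dist_lineMap_lineMap, dist_lineMap_left, dist_lineMap_left, Real.dist_eq,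
        Real.norm_of_nonneg hp.1, Real.norm_of_nonneg hq.1, ← sub_mul, abs_mul,
        abs_of_nonneg (dist_nonneg (x := a) (y := b))]
    rw [this]
    nlinarith [abs_nonneg (dist (AffineMap.lineMap a b p) a - dist (AffineMap.lineMap a b q) a)]

/-- on a generalized segment, the 1-dimensional Hausdorff measure of any
closed connected subset is at most `(1+ξ)` times its diameter. -/
theorem genSeg_hausdorff_le_diam (x1 x2 y1 y2 : ℝ) (hx : x1 < x2) (hy : y1 < y2)
    (a b : E2) (hab : a ≠ b)
    (ha : a ∈ frontier {z : E2 | z 0 ∈ Set.Icc x1 x2 ∧ z 1 ∈ Set.Icc y1 y2})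
    (hb : b ∈ frontier {z : E2 | z 0 ∈ Set.Icc x1 x2 ∧ z 1 ∈ Set.Icc y1 y2})
    (ξ : ℝ) (hξ : 0 < ξ) (S : Set E2) (hS : IsGenSeg x1 x2 y1 y2 a b ξ S)
    (T : Set E2) (hTS : T ⊆ S) (hTclosed : IsClosed T) (hTconn : IsConnected T) :
    μH[1] T ≤ ENNReal.ofReal ((1 + ξ) * Metric.diam T) := by
  rcases hS with ⟨_, rfl⟩ | ⟨h1, h2, rfl⟩ | ⟨h1, h2, rfl⟩ | ⟨h1, h2, rfl⟩ | ⟨h1, h2, rfl⟩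
  · exact genSeg_straight a b ξ hξ T hTS
  · exact genSeg_bent 0 1 (by decide) a b (h1.trans h2.symm) ξ 1 hξ (by simp) T hTS
  · exact genSeg_bent 0 1 (by decide) a b (h1.trans h2.symm) ξ (-1) hξ (by simp) T hTS
  · exact genSeg_bent 1 0 (by decide) a b (h1.trans h2.symm) ξ 1 hξ (by simp) T hTS
  · exact genSeg_bent 1 0 (by decide) a b (h1.trans h2.symm) ξ (-1) hξ (by simp) T hTS
end
end

section
/- Let f : ℝ² → ℝ ∪ {+∞} be finite at every point of ℝ² \ {0} and satisfy the restricted convexity inequality f(t a + (1−t) b) ≤ t f(a) + (1−t) f(b) for every t ∈ (0,1) and every pair of linearly independent vectors a, b ∈ ℝ². Then f is continuous (as a real-valued function) at every point of ℝ² \ {0}. -/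
open MeasureTheory Set Filter Topology
open scoped ENNReal NNReal

noncomputable section

lemma li_of_det (a b : E2) (h : a 0 * b 1 - a 1 * b 0 ≠ 0) : LinearIndependent ℝ ![a, b] := by
  rw [LinearIndependent.pair_iff]
  intro s t hst
  have h0 : s * a 0 + t * b 0 = 0 := by simpa using congrArg (fun v : E2 => v 0) hst
  have h1 : s * a 1 + t * b 1 = 0 := by simpa using congrArg (fun v : E2 => v 1) hst
  constructor
  · have : s * (a 0 * b 1 - a 1 * b 0) = 0 := by linear_combination b 1 * h0 - b 0 * h1
    exact (mul_eq_zero.mp this).resolve_right h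
  · have : t * (a 0 * b 1 - a 1 * b 0) = 0 := by linear_combination a 0 * h1 - a 1 * h0
    exact (mul_eq_zero.mp this).resolve_right h

lemma ne_zero_of_det_left (a b : E2) (h : a 0 * b 1 - a 1 * b 0 ≠ 0) : a ≠ 0 := by
  rintro rfl; simp at h

lemma sq_pos_of_ne (a : E2) (h : a ≠ 0) : 0 < a 0 ^ 2 + a 1 ^ 2 := by
  by_contra hc
  apply h
  ext i
  fin_cases i
  · simp; nlinarith [sq_nonneg (a 0), sq_nonneg (a 1)]
  · simp; nlinarith [sq_nonneg (a 0), sq_nonneg (a 1)]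

lemma real_conv (f : E2 → EReal)
    (hfin : ∀ a : E2, a ≠ 0 → f a ≠ ⊤ ∧ f a ≠ ⊥)
    (hconv : ∀ a b : E2, LinearIndependent ℝ ![a, b] →
      ∀ t : ℝ, t ∈ Set.Ioo (0:ℝ) 1 →
        f (t • a + (1 - t) • b) ≤ (t : EReal) * f a + ((1 - t) : EReal) * f b)
    (a b : E2) (h : a 0 * b 1 - a 1 * b 0 ≠ 0) (t : ℝ) (ht : t ∈ Set.Ioo (0:ℝ) 1) :
    (f (t • a + (1 - t) • b)).toReal ≤ t * (f a).toReal + (1 - t) * (f b).toReal := by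
  have ha : a ≠ 0 := ne_zero_of_det_left a b h
  have hb : b ≠ 0 := by rintro rfl; simp at h
  have hz : t • a + (1 - t) • b ≠ 0 := by
    apply ne_zero_of_det_left _ b
    have : t * (a 0 * b 1 - a 1 * b 0) ≠ 0 := mul_ne_zero ht.1.ne' h
    convert this using 1
    simp
    ring
  have key := hconv a b (li_of_det a b h) t ht
  rw [← EReal.coe_toReal (hfin a ha).1 (hfin a ha).2, ← EReal.coe_toReal (hfin b hb).1 (hfin b hb).2,
    ← EReal.coe_toReal (hfin _ hz).1 (hfin _ hz).2] at key
  exact_mod_cast key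

lemma line_cont (g : E2 → ℝ)
    (hg : ∀ a b : E2, a 0 * b 1 - a 1 * b 0 ≠ 0 → ∀ t : ℝ, t ∈ Set.Ioo (0:ℝ) 1 →
      g (t • a + (1 - t) • b) ≤ t * g a + (1 - t) * g b)
    (p v : E2) (h : p 0 * v 1 - p 1 * v 0 ≠ 0) : Continuous fun s : ℝ => g (p + s • v) := by
  have hc : ConvexOn ℝ univ fun s : ℝ => g (p + s • v) := by
    refine ⟨convex_univ, ?_⟩
    intro x _ y _ t u ht hu htu
    obtain rfl : u = 1 - t := by linarith
    rcases eq_or_ne x y with rfl | hxy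
    · simp only [← add_smul, htu, one_smul]; exact le_rfl
    rcases ht.eq_or_lt with rfl | ht
    · simp
    rcases hu.eq_or_lt with hu | hu
    · obtain rfl : t = 1 := by linarith
      simp
    have hd := hg (p + x • v) (p + y • v) (by
      have : (y - x) * (p 0 * v 1 - p 1 * v 0) ≠ 0 := mul_ne_zero (sub_ne_zero.2 hxy.symm) h
      convert this using 1
      simp
      ring) t ⟨ht, by linarith⟩
    have he : p + (t • x + (1 - t) • y) • v = t • (p + x • v) + (1 - t) • (p + y • v) := by
      simp only [smul_eq_mul]
      module
    change g (p + (t • x + (1 - t) • y) • v) ≤ t * g (p + x • v) + (1 - t) * g (p + y • v)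
    rw [he]
    exact hd
  rw [← continuousOn_univ]
  exact hc.continuousOn isOpen_univ

lemma conv_full (g : E2 → ℝ)
    (hg : ∀ a b : E2, a 0 * b 1 - a 1 * b 0 ≠ 0 → ∀ t : ℝ, t ∈ Set.Ioo (0:ℝ) 1 →
      g (t • a + (1 - t) • b) ≤ t * g a + (1 - t) * g b)
    (x y : E2) (hx : x ≠ 0) (hy : y ≠ 0) (t : ℝ) (ht : t ∈ Set.Ioo (0:ℝ) 1)
    (hz : t • x + (1 - t) • y ≠ 0) :
    g (t • x + (1 - t) • y) ≤ t * g x + (1 - t) * g y := by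
  by_cases hd : x 0 * y 1 - x 1 * y 0 = 0
  swap
  · exact hg x y hd t ht
  set v : E2 := !₂[-x 1, x 0] with hv
  have v0 : v 0 = -x 1 := by simp [hv]
  have v1 : v 1 = x 0 := by simp [hv]
  have hx2 := sq_pos_of_ne x hx
  have aux : ∀ w : E2, w ≠ 0 → x 0 * w 1 - x 1 * w 0 = 0 → w 0 * v 1 - w 1 * v 0 ≠ 0 := by
    intro w hw hdw h0
    rw [v0, v1] at h0
    have h2 := mul_pos hx2 (sq_pos_of_ne w hw)
    have : (x 0 ^ 2 + x 1 ^ 2) * (w 0 ^ 2 + w 1 ^ 2) = 0 := by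
      linear_combination (x 0 * w 1 - x 1 * w 0) * hdw + (w 0 * x 0 + w 1 * x 1) * h0
    linarith
  have cx := line_cont g hg x v (aux x hx (by ring))
  have cy := line_cont g hg y v (aux y hy hd)
  have hzv := aux _ hz (by simp; linear_combination (1 - t) * hd)
  have hlim : Tendsto (fun s : ℝ => t * g (x + ((1 - t) * s) • v) + (1 - t) * g (y + (-t * s) • v))
      (𝓝[≠] 0) (𝓝 (t * g x + (1 - t) * g y)) := by
    have c1 : Continuous fun s : ℝ => g (x + ((1 - t) * s) • v) :=
      cx.comp (continuous_const.mul continuous_id)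
    have c2 : Continuous fun s : ℝ => g (y + (-t * s) • v) :=
      cy.comp (continuous_const.mul continuous_id)
    have c3 : Continuous fun s : ℝ =>
        t * g (x + ((1 - t) * s) • v) + (1 - t) * g (y + (-t * s) • v) :=
      (continuous_const.mul c1).add (continuous_const.mul c2)
    have h3 := c3.tendsto 0
    have e1 : x + ((1 - t) * 0) • v = x := by simp
    have e2 : y + (-t * 0) • v = y := by simp
    rw [e1, e2] at h3
    exact h3.mono_left nhdsWithin_le_nhds
  refine ge_of_tendsto hlim ?_
  filter_upwards [self_mem_nhdsWithin] with s hs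
  have hs : s ≠ 0 := hs
  have := hg (x + ((1 - t) * s) • v) (y + (-t * s) • v) (by
    have := mul_ne_zero (neg_ne_zero.2 hs) hzv
    intro h0
    apply this
    simp only [PiLp.add_apply, PiLp.smul_apply, smul_eq_mul] at h0 ⊢
    linear_combination h0 - hd) t ht
  have he : t • x + (1 - t) • y
      = t • (x + ((1 - t) * s) • v) + (1 - t) • (y + (-t * s) • v) := by module
  rw [he]
  exact this

/-- a function `f : ℝ² → ℝ ∪ {+∞}` that is finite away from `0` and
satisfies the convexity inequality along every pair of linearly independent vectors
is continuous (real-valued) at every point of `ℝ² \ {0}`. -/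
theorem continuousAt_of_convex_on_independent (f : E2 → EReal)
    (hfin : ∀ a : E2, a ≠ 0 → f a ≠ ⊤ ∧ f a ≠ ⊥)
    (hconv : ∀ a b : E2, LinearIndependent ℝ ![a, b] →
      ∀ t : ℝ, t ∈ Set.Ioo (0:ℝ) 1 →
        f (t • a + (1 - t) • b) ≤ (t : EReal) * f a + ((1 - t) : EReal) * f b) :
    ∀ a : E2, a ≠ 0 → ContinuousAt f a := by
  intro a ha
  have hg := real_conv f hfin hconv
  have h0 : ∀ x ∈ Metric.ball a ‖a‖, x ≠ 0 := by
    rintro x hx rfl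
    simp at hx
  have hc : ConvexOn ℝ (Metric.ball a ‖a‖) fun x => (f x).toReal := by
    refine ⟨convex_ball _ _, ?_⟩
    intro x hx y hy t u ht hu htu
    have hz := h0 _ (convex_ball a ‖a‖ hx hy ht hu htu)
    obtain rfl : u = 1 - t := by linarith
    rcases ht.eq_or_lt with rfl | ht
    · simp
    rcases hu.eq_or_lt with hu | hu
    · obtain rfl : t = 1 := by linarith
      simp
    exact conv_full (fun x => (f x).toReal) hg x y (h0 x hx) (h0 y hy) t ⟨ht, by linarith⟩ hz
  have hmem : Metric.ball a ‖a‖ ∈ 𝓝 a := Metric.ball_mem_nhds a (norm_pos_iff.2 ha)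
  have hca := (hc.continuousOn Metric.isOpen_ball).continuousAt hmem
  have hca' : ContinuousAt (fun x => (((f x).toReal : ℝ) : EReal)) a :=
    continuous_coe_real_ereal.continuousAt.comp hca
  refine hca'.congr ?_
  filter_upwards [hmem] with x hx
  exact EReal.coe_toReal (hfin x (h0 x hx)).1 (hfin x (h0 x hx)).2
end
end
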